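/- arXiv:1705.08300 — 5 statements merged into one kernel-verified Lean document; each statement's English description precedes it below -/
import Mathlib

section
/- Let W be a real separable Banach space and let μ be a centered Gaussian measure on W. Let h ∈ W be such that sup{ ℓ(h) : ℓ ∈ W*, Cov_μ(ℓ,ℓ) ≤ 1 } < ∞ (i.e. h lies in the Cameron–Martin space H_μ). Then the pushforward of μ under the translation map T_h : x ↦ x + h is mutually absolutely continuous with μ (each measure is absolutely continuous with respect to the other). -/
open MeasureTheory ProbabilityTheory NNReal

/-- A Borel probability measure on a real Banach space is a *centered Gaussian measure*
if the pushforward under every continuous linear functional is a (possibly degenerate)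
centered real Gaussian measure. -/
def IsCenteredGaussian {W : Type*} [NormedAddCommGroup W] [NormedSpace ℝ W]
    [MeasurableSpace W] (μ : Measure W) : Prop :=
  ∀ ℓ : W →L[ℝ] ℝ, ∃ v : ℝ≥0, μ.map ℓ = gaussianReal 0 v

lemma cmAux_lip {W : Type*} [MeasurableSpace W] (μ : Measure W) [IsProbabilityMeasure μ] :
    Continuous (fun u : Lp ℝ 2 μ => ∫ x, Complex.exp (Complex.I * (u x : ℝ)) ∂μ) := by
  have hint : ∀ u : Lp ℝ 2 μ, Integrable (fun x => Complex.exp (Complex.I * (u x : ℝ))) μ := by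
    intro u
    refine (integrable_const (1 : ℝ)).mono' ?_ (ae_of_all _ fun x => ?_)
    · have := (Lp.stronglyMeasurable u).measurable
      exact (by fun_prop : Measurable _).aestronglyMeasurable
    · rw [Complex.norm_exp_I_mul_ofReal]
  refine LipschitzWith.continuous (K := 1) (LipschitzWith.of_dist_le_mul fun u v => ?_)
  rw [dist_eq_norm, dist_eq_norm, ← integral_sub (hint u) (hint v), NNReal.coe_one, one_mul]
  have hm : MemLp (u - v : Lp ℝ 2 μ) 2 μ := Lp.memLp _
  have hm1 : Integrable (u - v : Lp ℝ 2 μ) μ := hm.integrable (by norm_num)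
  calc _ ≤ ∫ x, ‖Complex.exp (Complex.I * (u x : ℝ)) - Complex.exp (Complex.I * (v x : ℝ))‖ ∂μ :=
        norm_integral_le_integral_norm _
    _ ≤ ∫ x, ‖(u - v : Lp ℝ 2 μ) x‖ ∂μ := by
        refine integral_mono_ae ((hint u).sub (hint v)).norm hm1.norm ?_
        filter_upwards [Lp.coeFn_sub u v] with x hx
        rw [hx, Pi.sub_apply]
        have : Complex.exp (Complex.I * (u x : ℝ)) - Complex.exp (Complex.I * (v x : ℝ))
          = Complex.exp (Complex.I * (v x : ℝ)) *
            (Complex.exp (Complex.I * ((u x - v x : ℝ) : ℂ)) - 1) := by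
          rw [mul_sub, ← Complex.exp_add]; push_cast; ring_nf
        rw [this, norm_mul, Complex.norm_exp_I_mul_ofReal, one_mul]
        exact Real.norm_exp_I_mul_ofReal_sub_one_le
    _ = (eLpNorm (u - v : Lp ℝ 2 μ) 1 μ).toReal := by
        rw [eLpNorm_one_eq_lintegral_enorm, integral_norm_eq_lintegral_enorm hm1.1]
    _ ≤ (eLpNorm (u - v : Lp ℝ 2 μ) 2 μ).toReal := by
        refine ENNReal.toReal_mono hm.2.ne ?_
        exact eLpNorm_le_eLpNorm_of_exponent_le (by norm_num) hm.1
    _ = ‖u - v‖ := by rw [Lp.norm_def]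

theorem cameronMartin_translate_absolutelyContinuous
    {W : Type*} [NormedAddCommGroup W] [NormedSpace ℝ W] [CompleteSpace W]
    [TopologicalSpace.SeparableSpace W] [MeasurableSpace W] [BorelSpace W]
    (μ : Measure W) [IsProbabilityMeasure μ] (hμ : IsCenteredGaussian μ)
    (h : W)
    (hh : BddAbove {r : ℝ | ∃ ℓ : W →L[ℝ] ℝ, (∫ x, ℓ x * ℓ x ∂μ) ≤ 1 ∧ ℓ h = r}) :
    μ.map (fun x => x + h) ≪ μ ∧ μ ≪ μ.map (fun x => x + h) := by
  have : SecondCountableTopology W := UniformSpace.secondCountable_of_separable W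
  have hG : IsGaussian μ := isGaussian_of_map_eq_gaussianReal fun L => ⟨0, hμ L⟩
  have hid : MemLp id 2 μ := IsGaussian.memLp_two_id
  let ι : StrongDual ℝ W →ₗ[ℝ] Lp ℝ 2 μ := (StrongDual.toLp μ 2).toLinearMap
  have hι : ∀ ℓ : StrongDual ℝ W, ι ℓ =ᵐ[μ] ℓ := by
    intro ℓ
    change (StrongDual.toLp μ 2 ℓ : Lp ℝ 2 μ) =ᵐ[μ] ℓ
    rw [StrongDual.toLp_apply hid]
    exact MemLp.coeFn_toLp _
  have hnorm : ∀ ℓ : StrongDual ℝ W, ‖ι ℓ‖ ^ 2 = ∫ x, ℓ x * ℓ x ∂μ := by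
    intro ℓ
    rw [← real_inner_self_eq_norm_sq, L2.inner_def]
    refine integral_congr_ae ?_
    filter_upwards [hι ℓ] with x hx
    rw [hx]; simp [sq]
  have hchar : ∀ ℓ : StrongDual ℝ W, charFunDual μ ℓ = Complex.exp (-(‖ι ℓ‖ ^ 2 : ℝ) / 2) := by
    intro ℓ
    obtain ⟨v, hv⟩ := hμ ℓ
    have h2 : ‖ι ℓ‖ ^ 2 = v := by
      rw [hnorm, ← integral_map (f := fun y : ℝ => y * y) (φ := ℓ) (by fun_prop) (by fun_prop), hv]
      have := variance_id_gaussianReal (μ := 0) (v := v)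
      rw [variance_of_integral_eq_zero (by fun_prop) (by simp)] at this
      simpa [sq] using this
    rw [charFunDual_eq_charFun_map_one, hv, charFun_gaussianReal, h2]
    congr 1
    simp [neg_div]
  -- bound
  obtain ⟨M, hM⟩ := hh
  have hM0 : 0 ≤ M := hM ⟨0, by simp, by simp⟩
  have hb1 : ∀ ℓ : StrongDual ℝ W, ℓ h ≤ M * ‖ι ℓ‖ := by
    intro ℓ
    refine le_of_forall_pos_le_add fun ε hε => ?_
    set δ : ℝ := ε / (M + 1) with hδ
    have hδ0 : 0 < δ := by positivity
    have hc : 0 < ‖ι ℓ‖ + δ := by positivity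
    have := hM ⟨(‖ι ℓ‖ + δ)⁻¹ • ℓ, by
      rw [← hnorm, map_smul, norm_smul, Real.norm_of_nonneg (by positivity), inv_mul_eq_div]
      exact pow_le_one₀ (by positivity) ((div_le_one hc).2 (by linarith)), rfl⟩
    simp only [ContinuousLinearMap.smul_apply, smul_eq_mul] at this
    rw [inv_mul_le_iff₀ hc] at this
    have h3 : M * δ ≤ ε := by
      rw [hδ, mul_div_assoc', div_le_iff₀ (by positivity)]; nlinarith
    nlinarith
  have hb : ∀ ℓ : StrongDual ℝ W, ‖ℓ h‖ ≤ M * ‖ι ℓ‖ := by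
    intro ℓ
    have := hb1 (-ℓ)
    rw [map_neg, norm_neg] at this
    exact abs_le.2 ⟨by simp at this; linarith, hb1 ℓ⟩
  -- Riesz
  obtain ⟨Z, hZcl, hZ⟩ : ∃ Z ∈ (LinearMap.range ι).topologicalClosure,
      ∀ ℓ : StrongDual ℝ W, inner ℝ Z (ι ℓ) = ℓ h := by
    set K := (LinearMap.range ι).topologicalClosure with hK
    have : CompleteSpace K := (Submodule.isClosed_topologicalClosure _).completeSpace_coe
    let e : StrongDual ℝ W →ₗ[ℝ] K := ι.codRestrict K fun ℓ =>
      Submodule.le_topologicalClosure _ ⟨ℓ, rfl⟩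
    have hd : DenseRange e := by
      intro y
      rw [Metric.mem_closure_iff]
      intro ε hε
      obtain ⟨_, ⟨ℓ, rfl⟩, hb⟩ := Metric.mem_closure_iff.1 (y.2 : (y : Lp ℝ 2 μ) ∈ closure _) ε hε
      exact ⟨e ℓ, ⟨ℓ, rfl⟩, hb⟩
    let f : StrongDual ℝ W →ₗ[ℝ] ℝ := (ContinuousLinearMap.apply ℝ ℝ h).toLinearMap
    let g := f.extendOfNorm e
    refine ⟨((InnerProductSpace.toDual ℝ K).symm g : K), Subtype.coe_prop _, fun ℓ => ?_⟩
    have h1 : g (e ℓ) = ℓ h := LinearMap.extendOfNorm_eq hd ⟨M, hb⟩ ℓ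
    rw [← h1, ← InnerProductSpace.toDual_symm_apply]
    rfl
  have hcl : ∀ u ∈ (LinearMap.range ι).topologicalClosure,
      ∫ x, Complex.exp (Complex.I * (u x : ℝ)) ∂μ = Complex.exp (-(‖u‖ ^ 2 : ℝ) / 2) := by
    intro u hu
    have hclosed : IsClosed {u : Lp ℝ 2 μ | ∫ x, Complex.exp (Complex.I * (u x : ℝ)) ∂μ
        = Complex.exp (-(‖u‖ ^ 2 : ℝ) / 2)} :=
      isClosed_eq (cmAux_lip μ) (by fun_prop)
    refine closure_minimal ?_ hclosed hu
    rintro _ ⟨ℓ, rfl⟩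
    rw [Set.mem_setOf_eq, ← hchar, charFunDual_apply]
    refine integral_congr_ae ?_
    filter_upwards [hι ℓ] with x hx
    rw [hx, mul_comm]
  by_cases hZ0 : Z = 0
  · have : h = 0 := by
      refine NormedSpace.eq_zero_of_forall_dual_eq_zero (𝕜 := ℝ) fun ℓ => ?_
      rw [← hZ ℓ, hZ0, inner_zero_left]
    subst this
    simp [Measure.AbsolutelyContinuous.rfl]
  have hs : 0 < ‖Z‖ ^ 2 := by positivity
  let v : ℝ≥0 := ⟨(‖Z‖ ^ 2)⁻¹, by positivity⟩
  have hvs : (v : ℝ) = (‖Z‖ ^ 2)⁻¹ := rfl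
  have hv0 : v ≠ 0 := by
    intro h0
    have : (v : ℝ) = 0 := by rw [h0]; rfl
    rw [hvs] at this
    exact (inv_pos.2 hs).ne' this
  have hZm : Measurable (Z : W → ℝ) := (Lp.stronglyMeasurable Z).measurable
  let Y : W → W := fun x => x - ((v : ℝ) * Z x) • h
  have hY : Measurable Y := by fun_prop
  let ρ : Measure W := μ.map Y
  have : IsProbabilityMeasure ρ := Measure.isProbabilityMeasure_map hY.aemeasurable
  let S : ℝ →L[ℝ] W := ContinuousLinearMap.toSpanSingleton ℝ h
  have hρ : ∀ ℓ : StrongDual ℝ W, charFunDual ρ ℓ =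
      Complex.exp (-(‖ι ℓ‖ ^ 2 - v * (ℓ h) ^ 2 : ℝ) / 2) := by
    intro ℓ
    have hu : ι ℓ - ((v : ℝ) * ℓ h) • Z ∈ (LinearMap.range ι).topologicalClosure :=
      Submodule.sub_mem _ (Submodule.le_topologicalClosure _ ⟨ℓ, rfl⟩)
        (Submodule.smul_mem _ _ hZcl)
    have h1 := hcl _ hu
    have h2 : ‖ι ℓ - ((v : ℝ) * ℓ h) • Z‖ ^ 2 = ‖ι ℓ‖ ^ 2 - v * (ℓ h) ^ 2 := by
      rw [norm_sub_sq_real, norm_smul, mul_pow, inner_smul_right, real_inner_comm, hZ,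
        Real.norm_eq_abs, sq_abs, hvs]
      field_simp
      ring
    rw [h2] at h1
    rw [← h1, charFunDual_apply, integral_map hY.aemeasurable (by fun_prop)]
    refine integral_congr_ae ?_
    filter_upwards [hι ℓ, Lp.coeFn_sub (ι ℓ) (((v : ℝ) * ℓ h) • Z),
      Lp.coeFn_smul ((v : ℝ) * ℓ h) Z] with x hx1 hx2 hx3
    rw [hx2, Pi.sub_apply, hx3, hx1]
    simp only [Y, map_sub, map_smul, smul_eq_mul, Pi.smul_apply]
    push_cast
    ring_nf
  have hμeq : μ = (ρ.prod (gaussianReal 0 v)).map (fun p => p.1 + S p.2) := by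
    have : (ρ.prod (gaussianReal 0 v)).map (fun p => p.1 + S p.2)
        = Measure.conv ρ ((gaussianReal 0 v).map S) := by
      have h2 : ρ.prod ((gaussianReal 0 v).map S) =
          (ρ.prod (gaussianReal 0 v)).map (Prod.map id S) := by
        rw [← Measure.map_prod_map _ _ measurable_id (by fun_prop), Measure.map_id]
      rw [Measure.conv, h2, Measure.map_map (by fun_prop) (by fun_prop)]
      rfl
    rw [this]
    have : IsProbabilityMeasure ((gaussianReal 0 v).map S) :=
      Measure.isProbabilityMeasure_map (by fun_prop)
    refine Measure.ext_of_charFunDual ?_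
    ext ℓ
    rw [charFunDual_conv, hρ, hchar, charFunDual_map, charFunDual_eq_charFun_map_one]
    have : (gaussianReal 0 v).map (ℓ.comp S) = (gaussianReal 0 v).map (ℓ h * ·) := by
      congr 1
      ext x
      simp [S, mul_comm]
    rw [this, gaussianReal_map_const_mul, charFun_gaussianReal, ← Complex.exp_add]
    congr 1
    simp
    ring
  have hadd : μ.map (fun x => x + h) =
      (ρ.prod (gaussianReal 1 v)).map (fun p => p.1 + S p.2) := by
    have h1 : gaussianReal 1 v = (gaussianReal 0 v).map (· + 1) := by
      rw [gaussianReal_map_add_const, zero_add]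
    have h2 : ρ.prod (gaussianReal 1 v) =
        (ρ.prod (gaussianReal 0 v)).map (Prod.map id (· + 1)) := by
      rw [h1, ← Measure.map_prod_map _ _ measurable_id (by fun_prop), Measure.map_id]
    rw [h2, Measure.map_map (by fun_prop) (by fun_prop)]
    conv_lhs => rw [hμeq]
    rw [Measure.map_map (by fun_prop) (by fun_prop)]
    congr 1
    ext p
    simp [S, add_smul, add_assoc]
  have hac : ∀ a b : ℝ, gaussianReal a v ≪ gaussianReal b v := fun a b =>
    (gaussianReal_absolutelyContinuous a hv0).trans (gaussianReal_absolutelyContinuous' b hv0)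
  have hfin : ∀ a b : ℝ, (ρ.prod (gaussianReal a v)).map (fun p => p.1 + S p.2) ≪
      (ρ.prod (gaussianReal b v)).map (fun p => p.1 + S p.2) := fun a b =>
    (Measure.AbsolutelyContinuous.rfl.prod (hac a b)).map (by fun_prop)
  rw [hadd]
  constructor
  · conv_rhs => rw [hμeq]
    exact hfin 1 0
  · conv_lhs => rw [hμeq]
    exact hfin 0 1
end

section
/- Let W be a real separable Banach space, μ a centered Gaussian measure on W, and h ∈ W with s := ‖h‖_μ = sup{ ℓ(h) : ℓ ∈ W*, Cov_μ(ℓ,ℓ) ≤ 1 } < ∞. Then the lattice infimum (the 'join') of the two probability measures μ and T_h#μ has total mass equal to twice the probability that a standard real Gaussian random variable exceeds s/2: (μ ⊓ (T_h#μ))(W) = 2·γ([s/2, ∞)), where γ is the standard Gaussian measure N(0,1) on ℝ. -/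
open MeasureTheory ProbabilityTheory NNReal

open Complex in
lemma aux_norm_exp (a b : ℝ) : ‖exp (a * I) - exp (b * I)‖ ≤ ‖a - b‖ := by
  have h1 : exp (a * I) - exp (b * I) = exp (b * I) * (exp (I * ((a - b : ℝ) : ℂ)) - 1) := by
    rw [mul_sub, ← exp_add, mul_one]
    congr 2
    push_cast; ring
  rw [h1, norm_mul, norm_exp_ofReal_mul_I, one_mul]
  exact Real.norm_exp_I_mul_ofReal_sub_one_le

section core
variable {Ω : Type*} [MeasurableSpace Ω] {P : Measure Ω} [IsProbabilityMeasure P]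

lemma aux_integrable_exp {f : Ω → ℝ} (hf : AEStronglyMeasurable f P) :
    Integrable (fun x => Complex.exp (f x * Complex.I)) P := by
  refine Integrable.of_bound (C := 1) ?_ (ae_of_all _ fun x => ?_)
  · exact (by fun_prop : Continuous fun r : ℝ =>
      Complex.exp (r * Complex.I)).comp_aestronglyMeasurable hf
  · rw [Complex.norm_exp_ofReal_mul_I]

lemma aux_continuous : Continuous
    (fun f : Lp ℝ 2 P => ∫ x, Complex.exp (f x * Complex.I) ∂P) := by
  have : LipschitzWith 1 (fun f : Lp ℝ 2 P => ∫ x, Complex.exp (f x * Complex.I) ∂P) := by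
    refine LipschitzWith.of_dist_le_mul fun f g => ?_
    rw [dist_eq_norm, dist_eq_norm, NNReal.coe_one, one_mul,
      ← integral_sub (aux_integrable_exp (Lp.aestronglyMeasurable f))
        (aux_integrable_exp (Lp.aestronglyMeasurable g))]
    refine (norm_integral_le_integral_norm _).trans ?_
    have hi : Integrable (f - g : Lp ℝ 2 P) P :=
      (Lp.memLp (f - g)).integrable (by norm_num)
    calc ∫ x, ‖Complex.exp (f x * Complex.I) - Complex.exp (g x * Complex.I)‖ ∂P
        ≤ ∫ x, ‖(f - g : Lp ℝ 2 P) x‖ ∂P := by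
          refine integral_mono_ae ?_ hi.norm ?_
          · exact ((aux_integrable_exp (Lp.aestronglyMeasurable f)).sub
              (aux_integrable_exp (Lp.aestronglyMeasurable g))).norm
          · filter_upwards [Lp.coeFn_sub f g] with x hx
            rw [hx]
            exact aux_norm_exp _ _
      _ = (eLpNorm (f - g : Lp ℝ 2 P) 1 P).toReal := by
          rw [integral_norm_eq_lintegral_enorm hi.1, eLpNorm_one_eq_lintegral_enorm]
      _ ≤ ‖f - g‖ := by
          rw [Lp.norm_def]
          refine ENNReal.toReal_mono (Lp.eLpNorm_ne_top _) ?_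
          exact eLpNorm_le_eLpNorm_of_exponent_le (by norm_num) (Lp.aestronglyMeasurable _)
  exact this.continuous

/-- closed Gaussian subspace -/
def GaussSub (S : Submodule ℝ (Lp ℝ 2 P)) : Prop :=
  ∀ f ∈ S, ∫ x, Complex.exp (f x * Complex.I) ∂P = Complex.exp (-(‖f‖ ^ 2 / 2 : ℝ))

lemma GaussSub.closure {S : Submodule ℝ (Lp ℝ 2 P)} (hS : GaussSub S) :
    GaussSub S.topologicalClosure := by
  intro f hf
  have hc : IsClosed {f : Lp ℝ 2 P | ∫ x, Complex.exp (f x * Complex.I) ∂P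
      = Complex.exp (-(‖f‖ ^ 2 / 2 : ℝ))} :=
    isClosed_eq aux_continuous (by fun_prop)
  exact closure_minimal (fun f hf => hS f hf) hc hf

lemma GaussSub.law {S : Submodule ℝ (Lp ℝ 2 P)} (hS : GaussSub S) {f : Lp ℝ 2 P} (hf : f ∈ S) :
    P.map f = gaussianReal 0 (‖f‖₊ ^ 2) := by
  have hm : AEMeasurable f P := (Lp.aestronglyMeasurable f).aemeasurable
  have := Measure.isProbabilityMeasure_map hm
  refine Measure.ext_of_charFun (funext fun t => ?_)
  rw [charFun_gaussianReal, charFun_apply_real, integral_map hm (by fun_prop)]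
  have h1 := hS _ (S.smul_mem t hf)
  rw [integral_congr_ae (g := fun x => Complex.exp (t * f x * Complex.I))] at h1
  · rw [h1]
    congr 1
    rw [norm_smul, mul_pow, Real.norm_eq_abs, sq_abs]
    push_cast
    simp
    ring
  · filter_upwards [Lp.coeFn_smul t f] with x hx
    rw [hx]; simp

lemma GaussSub.indep {S : Submodule ℝ (Lp ℝ 2 P)} (hS : GaussSub S) {f g : Lp ℝ 2 P} (hf : f ∈ S)
    (hg : g ∈ S) (hfg : inner ℝ f g = 0) : IndepFun f g P := by
  have hm : AEMeasurable f P := (Lp.aestronglyMeasurable f).aemeasurable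
  have hm' : AEMeasurable g P := (Lp.aestronglyMeasurable g).aemeasurable
  rw [indepFun_iff_charFun_prod hm hm']
  intro t
  rw [hS.law hf, hS.law hg, charFun_gaussianReal, charFun_gaussianReal, charFun_apply,
    integral_map (by fun_prop) (by fun_prop)]
  set a := t.ofLp.1
  set b := t.ofLp.2
  have h1 := hS _ (S.add_mem (S.smul_mem a hf) (S.smul_mem b hg))
  rw [integral_congr_ae (g := fun x => Complex.exp (((a * f x + b * g x : ℝ) : ℂ) * Complex.I))] at h1
  · simp only [WithLp.prod_inner_apply]
    simp only [RCLike.inner_apply, conj_trivial]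
    change ∫ x, Complex.exp (((a * f x + b * g x : ℝ) : ℂ) * Complex.I) ∂P = _
    rw [h1, ← Complex.exp_add, norm_add_sq_real, inner_smul_left, inner_smul_right, hfg]
    congr 1
    simp only [norm_smul, mul_pow, Real.norm_eq_abs, sq_abs]
    push_cast
    simp
    ring
  · filter_upwards [Lp.coeFn_smul a f, Lp.coeFn_smul b g, Lp.coeFn_add (a • f) (b • g)]
      with x hx hy hz
    rw [hz, Pi.add_apply, hx, hy]; simp

lemma GaussSub.cm {S : Submodule ℝ (Lp ℝ 2 P)} (hS : GaussSub S) {e f : Lp ℝ 2 P} (he : e ∈ S)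
    (hf : f ∈ S) (h1 : ‖e‖ = 1) (s : ℝ) :
    ∫ x, (Real.exp (s * e x - s ^ 2 / 2) : ℂ) * Complex.exp (f x * Complex.I) ∂P
      = Complex.exp (-(‖f‖ ^ 2 / 2 : ℝ)) * Complex.exp ((s * inner ℝ e f : ℝ) * Complex.I) := by
  set a : ℝ := inner ℝ e f with ha
  have hw : f - a • e ∈ S := S.sub_mem hf (S.smul_mem a he)
  set w := f - a • e with hwdef
  have hew : inner ℝ e w = 0 := by
    rw [hwdef, inner_sub_right, inner_smul_right, real_inner_self_eq_norm_sq, h1, ← ha]; ring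
  have hnw : ‖w‖ ^ 2 = ‖f‖ ^ 2 - a ^ 2 := by
    rw [hwdef, norm_sub_sq_real, inner_smul_right, real_inner_comm, ← ha, norm_smul, h1,
      Real.norm_eq_abs, mul_one, sq_abs]; ring
  have hind := hS.indep he hw hew
  have hm : AEMeasurable e P := (Lp.aestronglyMeasurable e).aemeasurable
  have hm' : AEMeasurable w P := (Lp.aestronglyMeasurable w).aemeasurable
  have key := hind.integral_comp_mul_comp (𝕜 := ℂ) (f := fun r : ℝ => Complex.exp ((s + a * Complex.I) * r))
    (g := fun r : ℝ => Complex.exp (r * Complex.I)) hm hm'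
    (by fun_prop) (by fun_prop)
  have hlaw := hS.law he
  have k1 : ∫ x, Complex.exp ((s + a * Complex.I) * e x) ∂P
      = Complex.exp ((s + a * Complex.I) ^ 2 / 2) := by
    have := complexMGF_gaussianReal hlaw (s + a * Complex.I)
    rw [complexMGF] at this
    rw [this]
    have : ‖e‖₊ = 1 := by ext; simpa using h1
    rw [this]; simp
  have k2 := hS w hw
  have : ∀ᵐ x ∂P, (Real.exp (s * e x - s ^ 2 / 2) : ℂ) * Complex.exp (f x * Complex.I)
      = Complex.exp (-(s ^ 2 / 2)) * (((fun r : ℝ => Complex.exp ((s + a * Complex.I) * r)) ∘ e)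
        * ((fun r : ℝ => Complex.exp (r * Complex.I)) ∘ w)) x := by
    filter_upwards [Lp.coeFn_sub f (a • e), Lp.coeFn_smul a e] with x hx hy
    simp only [Pi.mul_apply, Function.comp]
    rw [hwdef, hx, Pi.sub_apply, hy, Complex.ofReal_exp, ← Complex.exp_add, ← Complex.exp_add,
      ← Complex.exp_add]
    congr 1
    simp
    ring
  rw [integral_congr_ae this, integral_const_mul, key]
  simp only [Function.comp]
  rw [k1, k2, hnw, ← Complex.exp_add, ← Complex.exp_add, ← Complex.exp_add]
  congr 1
  push_cast
  ring_nf
  rw [Complex.I_sq]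
  ring
end core

section infpart
open ENNReal
variable {Ω : Type*} [MeasurableSpace Ω] {P : Measure Ω} [IsProbabilityMeasure P]

lemma aux_inf {ρ : Ω → ℝ≥0∞} (hρ : Measurable ρ) :
    (P ⊓ P.withDensity ρ) Set.univ
      = P {x | 1 ≤ ρ x} + P.withDensity ρ {x | 1 ≤ ρ x}ᶜ := by
  have hA : MeasurableSet {x | 1 ≤ ρ x} := measurableSet_le measurable_const hρ
  have heq : P {x | 1 ≤ ρ x} + P.withDensity ρ {x | 1 ≤ ρ x}ᶜ = ∫⁻ x, min 1 (ρ x) ∂P := by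
    rw [← lintegral_add_compl _ hA, withDensity_apply _ hA.compl]
    congr 1
    · rw [← setLIntegral_one]
      exact setLIntegral_congr_fun hA fun x hx => (min_eq_left hx).symm
    · exact setLIntegral_congr_fun hA.compl fun x hx => (min_eq_right (le_of_not_ge (fun h => hx h))).symm
  apply le_antisymm
  · rw [Measure.inf_apply MeasurableSet.univ]
    exact sInf_le ⟨{x | 1 ≤ ρ x}, by simp⟩
  · have hle : P.withDensity (fun x => min 1 (ρ x)) ≤ P ⊓ P.withDensity ρ := by
      refine le_inf ?_ ?_
      · calc _ ≤ P.withDensity 1 := withDensity_mono (ae_of_all _ fun x => min_le_left _ _)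
          _ = P := withDensity_one
      · exact withDensity_mono (ae_of_all _ fun x => min_le_right _ _)
    rw [heq]
    refine le_trans ?_ (hle Set.univ)
    rw [withDensity_apply _ MeasurableSet.univ, setLIntegral_univ]

lemma aux_tilt (s : ℝ) : (gaussianReal 0 1).withDensity
    (fun x => ENNReal.ofReal (Real.exp (s * x - s ^ 2 / 2))) = gaussianReal s 1 := by
  rw [gaussianReal_of_var_ne_zero _ one_ne_zero, gaussianReal_of_var_ne_zero _ one_ne_zero,
    ← withDensity_mul _ (measurable_gaussianPDF _ _) (by fun_prop)]
  congr 1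
  ext x
  simp only [Pi.mul_apply, gaussianPDF]
  rw [← ENNReal.ofReal_mul (gaussianPDFReal_nonneg _ _ _)]
  congr 1
  simp only [gaussianPDFReal]
  rw [mul_assoc, ← Real.exp_add]
  congr 2
  simp
  ring

lemma aux_mass {e : Ω → ℝ} (he : Measurable e) (hlaw : P.map e = gaussianReal 0 1) {s : ℝ}
    (hs : 0 < s) :
    (P ⊓ P.withDensity (fun x => ENNReal.ofReal (Real.exp (s * e x - s ^ 2 / 2)))) Set.univ
      = 2 * gaussianReal 0 1 (Set.Ici (s / 2)) := by
  rw [aux_inf (by fun_prop)]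
  have hA : {x | 1 ≤ ENNReal.ofReal (Real.exp (s * e x - s ^ 2 / 2))} = e ⁻¹' Set.Ici (s / 2) := by
    ext x
    simp only [Set.mem_ofPred_eq, Set.mem_preimage, Set.mem_Ici, ENNReal.one_le_ofReal,
      Real.one_le_exp_iff]
    constructor
    · intro h; nlinarith
    · intro h; nlinarith
  rw [hA, ← Set.preimage_compl, ← Measure.map_apply he measurableSet_Ici, hlaw, two_mul]
  congr 1
  rw [withDensity_apply _ (he measurableSet_Ici.compl), ← setLIntegral_map
    (f := fun y => ENNReal.ofReal (Real.exp (s * y - s ^ 2 / 2)))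
    measurableSet_Ici.compl (by fun_prop) he, hlaw,
    ← withDensity_apply _ measurableSet_Ici.compl, aux_tilt]
  have hmap := gaussianReal_map_const_sub (μ := 0) (v := 1) s
  rw [sub_zero] at hmap
  have := nullSingletonClass_gaussianReal (μ := 0) (v := 1) one_ne_zero
  rw [← hmap, Measure.map_apply (by fun_prop) measurableSet_Ici.compl,
    ← measure_congr (Ioi_ae_eq_Ici (μ := gaussianReal 0 1))]
  congr 1
  ext x
  simp only [Set.mem_preimage, Set.mem_compl_iff, Set.mem_Ici, Set.mem_Ioi, not_le]
  constructor <;> intro h <;> linarith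
end infpart

section riesz
variable {V H : Type*} [AddCommGroup V] [Module ℝ V] [NormedAddCommGroup H] [InnerProductSpace ℝ H]
  [CompleteSpace H]

lemma aux_riesz (ι : V →ₗ[ℝ] H) (F : V →ₗ[ℝ] ℝ) (s : ℝ)
    (hs : IsLUB {r : ℝ | ∃ v : V, ‖ι v‖ ^ 2 ≤ 1 ∧ F v = r} s) :
    ∃ z ∈ (LinearMap.range ι).topologicalClosure, ‖z‖ = s ∧ ∀ v, inner ℝ z (ι v) = F v := by
  have hs0 : 0 ≤ s := hs.1 ⟨0, by simp, by simp⟩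
  have hb0 : ∀ v, F v ≤ s * ‖ι v‖ := by
    intro v
    by_cases hv : ‖ι v‖ = 0
    · rw [hv, mul_zero]
      by_contra! hpos
      have := hs.1 ⟨((s + 1) / F v) • v, by simp [norm_smul, hv], rfl⟩
      rw [map_smul, smul_eq_mul, div_mul_cancel₀ _ hpos.ne'] at this
      linarith
    · have := hs.1 ⟨(‖ι v‖)⁻¹ • v, by simp [norm_smul, hv], rfl⟩
      have hv' : 0 < ‖ι v‖ := lt_of_le_of_ne (norm_nonneg _) (Ne.symm hv)
      rw [map_smul, smul_eq_mul, inv_mul_le_iff₀ hv'] at this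
      linarith
  have hb : ∀ v, ‖F v‖ ≤ s * ‖ι v‖ := by
    intro v
    rw [Real.norm_eq_abs, abs_le]
    have h1 := hb0 v
    have h2 := hb0 (-v)
    simp only [map_neg, norm_neg] at h2
    constructor <;> linarith
  set K := (LinearMap.range ι).topologicalClosure with hK
  have hKc : CompleteSpace K := (Submodule.isClosed_topologicalClosure _).completeSpace_coe
  have hmem : ∀ v, ι v ∈ K := fun v => Submodule.le_topologicalClosure _ ⟨v, rfl⟩
  let e : V →ₗ[ℝ] K := ι.codRestrict K hmem
  have hd : DenseRange e := by
    rintro ⟨y, hy⟩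
    rw [Topology.IsInducing.subtypeVal.closure_eq_preimage_closure_image]
    have : Subtype.val '' Set.range e = (LinearMap.range ι : Set H) := by
      rw [← Set.range_comp]; rfl
    have hy2 : y ∈ closure (LinearMap.range ι : Set H) := hy
    rw [← this] at hy2; exact hy2
  have hex := LinearMap.extendOfNorm_eq (f := F) hd ⟨s, hb⟩
  set G : K →L[ℝ] ℝ := F.extendOfNorm e
  let z : K := (InnerProductSpace.toDual ℝ K).symm G
  have hz : ∀ v, inner ℝ (z : H) (ι v) = F v := by
    intro v
    have : inner ℝ z (e v) = F v := by
      rw [InnerProductSpace.toDual_symm_apply, hex]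
    exact this
  refine ⟨z, z.2, le_antisymm ?_ ?_, hz⟩
  · have hcl : IsClosed {y : H | inner ℝ (z : H) y ≤ s * ‖y‖} :=
      isClosed_le (by fun_prop) (by fun_prop)
    have : inner ℝ (z : H) z ≤ s * ‖(z : H)‖ := by
      refine closure_minimal (s := (LinearMap.range ι : Set H)) ?_ hcl z.2
      rintro _ ⟨v, rfl⟩
      simp only [Set.mem_ofPred_eq]
      rw [hz]; exact hb0 v
    rw [real_inner_self_eq_norm_sq, sq] at this
    by_contra! hlt
    have := le_of_mul_le_mul_right this (hs0.trans_lt hlt)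
    linarith
  · refine hs.2 ?_
    rintro _ ⟨v, hv, rfl⟩
    rw [← hz]
    refine (real_inner_le_norm _ _).trans ?_
    have : ‖ι v‖ ≤ 1 := by nlinarith [norm_nonneg (ι v)]
    nlinarith [norm_nonneg (z : H)]
end riesz

/-- If `s = ‖h‖_μ < ∞` is the Cameron–Martin norm of `h`, then the lattice infimum ("join")
of `μ` and its translate by `h` has total mass `2·γ₁([s/2, ∞))`, where `γ₁ = N(0,1)`. -/
theorem mass_of_inf_translate_gaussian
    {W : Type*} [NormedAddCommGroup W] [NormedSpace ℝ W] [CompleteSpace W]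
    [TopologicalSpace.SeparableSpace W] [MeasurableSpace W] [BorelSpace W]
    (μ : Measure W) [IsProbabilityMeasure μ] (hμ : IsCenteredGaussian μ)
    (h : W) (s : ℝ)
    (hs : IsLUB {r : ℝ | ∃ ℓ : W →L[ℝ] ℝ, (∫ x, ℓ x * ℓ x ∂μ) ≤ 1 ∧ ℓ h = r} s) :
    (μ ⊓ μ.map (fun x => x + h)) Set.univ
      = 2 * gaussianReal 0 1 (Set.Ici (s / 2)) := by
  have hsc : SecondCountableTopology W := UniformSpace.secondCountable_of_separable W
  have hG : IsGaussian μ := isGaussian_of_map_eq_gaussianReal fun L => ⟨0, hμ L⟩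
  have hmem : ∀ ℓ : W →L[ℝ] ℝ, MemLp ℓ 2 μ := fun ℓ => IsGaussian.memLp_dual μ ℓ 2 (by simp)
  let ι : (W →L[ℝ] ℝ) →ₗ[ℝ] Lp ℝ 2 μ :=
    { toFun := fun ℓ => (hmem ℓ).toLp ℓ
      map_add' := fun a b => MemLp.toLp_add (hmem a) (hmem b)
      map_smul' := fun c a => MemLp.toLp_const_smul c (hmem a) }
  have hι : ∀ ℓ, ι ℓ =ᵐ[μ] ℓ := fun ℓ => (hmem ℓ).coeFn_toLp
  have hnorm : ∀ ℓ, ‖ι ℓ‖ ^ 2 = ∫ x, ℓ x * ℓ x ∂μ := by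
    intro ℓ
    rw [← real_inner_self_eq_norm_sq, L2.inner_def]
    refine integral_congr_ae ?_
    filter_upwards [hι ℓ] with x hx
    rw [hx]; simp [sq]
  let F : (W →L[ℝ] ℝ) →ₗ[ℝ] ℝ :=
    { toFun := fun ℓ => ℓ h
      map_add' := fun a b => rfl
      map_smul' := fun c a => rfl }
  have hs' : IsLUB {r : ℝ | ∃ v, ‖ι v‖ ^ 2 ≤ 1 ∧ F v = r} s := by
    simp only [hnorm]; exact hs
  obtain ⟨z, hzK, hzn, hz⟩ := aux_riesz ι F s hs'
  have hcf : ∀ ℓ : W →L[ℝ] ℝ, ∫ x, Complex.exp (ℓ x * Complex.I) ∂μ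
      = Complex.exp (-(‖ι ℓ‖ ^ 2 / 2 : ℝ)) := by
    intro ℓ
    obtain ⟨v, hv⟩ := hμ ℓ
    have h1 : ∫ x, Complex.exp (ℓ x * Complex.I) ∂μ = charFun (μ.map ℓ) 1 := by
      rw [charFun_apply_real, integral_map (by fun_prop) (by fun_prop)]
      simp
    have h2 : ∫ x, ℓ x * ℓ x ∂μ = v := by
      have h3 : ∫ x, ℓ x * ℓ x ∂μ = ∫ y, y * y ∂(μ.map ℓ) := by
        rw [integral_map (by fun_prop) (by fun_prop)]
      rw [h3, hv]
      have h4 := variance_fun_id_gaussianReal (μ := 0) (v := v)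
      rw [variance_of_integral_eq_zero (by fun_prop) integral_id_gaussianReal] at h4
      rw [← h4]
      exact integral_congr_ae (ae_of_all _ fun x => (sq x).symm)
    rw [h1, hv, charFun_gaussianReal, hnorm, h2]
    congr 1
    push_cast
    ring
  have hS0 : GaussSub (LinearMap.range ι) := by
    rintro _ ⟨ℓ, rfl⟩
    rw [← hcf]
    refine integral_congr_ae ?_
    filter_upwards [hι ℓ] with x hx
    rw [hx]
  have hS := hS0.closure
  have hs0 : 0 ≤ s := hzn ▸ norm_nonneg z
  rcases hs0.eq_or_lt with hs0 | hspos
  · have hz0 : z = 0 := by rw [← norm_eq_zero, hzn, hs0]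
    have hh : h = 0 := by
      by_contra hne
      obtain ⟨ℓ, hℓ⟩ := SeparatingDual.exists_ne_zero (R := ℝ) hne
      apply hℓ
      have := hz ℓ
      rw [hz0, inner_zero_left] at this
      exact this.symm
    subst hh
    have hmap := gaussianReal_map_const_sub (μ := 0) (v := 1) 0
    have := nullSingletonClass_gaussianReal (μ := 0) (v := 1) one_ne_zero
    have e1 : gaussianReal 0 1 (Set.Ici (s / 2)) = gaussianReal 0 1 (Set.Ici (s / 2))ᶜ := by
      rw [← hs0, zero_div]
      conv_rhs => rw [← sub_zero (0:ℝ), ← hmap]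
      rw [sub_zero, Measure.map_apply (by fun_prop) measurableSet_Ici.compl,
        ← measure_congr (Ioi_ae_eq_Ici (μ := gaussianReal 0 1))]
      congr 1
      ext x
      simp
    simp only [add_zero, Measure.map_id', inf_idem, measure_univ]
    rw [two_mul]
    conv_rhs => rw [e1]; arg 1; rw [← e1]
    rw [measure_add_measure_compl measurableSet_Ici, measure_univ]
  · set e := s⁻¹ • z with he
    have heK : e ∈ (LinearMap.range ι).topologicalClosure := Submodule.smul_mem _ _ hzK
    have hen : ‖e‖ = 1 := by
      rw [he, norm_smul, hzn, Real.norm_eq_abs, abs_of_pos (inv_pos.2 hspos),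
        inv_mul_cancel₀ hspos.ne']
    have hem : Measurable e := (Lp.stronglyMeasurable e).measurable
    have hlaw : μ.map e = gaussianReal 0 1 := by
      rw [hS.law heK]
      have : ‖e‖₊ = 1 := by ext; simpa using hen
      rw [this, one_pow]
    rw [← aux_mass hem hlaw hspos]
    congr 2
    set ρ : W → ℝ≥0 := fun x => Real.toNNReal (Real.exp (s * e x - s ^ 2 / 2)) with hρ
    have hρm : Measurable ρ := by fun_prop
    change _ = μ.withDensity (fun x => (ρ x : ENNReal))
    have hprob : IsFiniteMeasure (μ.withDensity (fun x => (ρ x : ENNReal))) := by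
      refine ⟨?_⟩
      have h1 : μ.withDensity (fun x => (ρ x : ENNReal)) Set.univ
          = (gaussianReal 0 1).withDensity
            (fun x => ENNReal.ofReal (Real.exp (s * x - s ^ 2 / 2))) Set.univ := by
        rw [withDensity_apply _ MeasurableSet.univ, withDensity_apply _ MeasurableSet.univ,
          ← hlaw, setLIntegral_univ, setLIntegral_univ, lintegral_map (by fun_prop) hem]
        rfl
      rw [h1, aux_tilt]
      exact measure_lt_top _ _
    have := Measure.isProbabilityMeasure_map (μ := μ) (f := fun x => x + h) (by fun_prop)
    refine Measure.ext_of_charFunDual (funext fun ℓ => ?_)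
    rw [charFunDual_map_add_const, charFunDual_apply, charFunDual_apply, hcf,
      integral_withDensity_eq_integral_smul hρm]
    have hcm := hS.cm heK (Submodule.le_topologicalClosure _ ⟨ℓ, rfl⟩ :
      ι ℓ ∈ (LinearMap.range ι).topologicalClosure) hen s
    have hin : s * inner ℝ e (ι ℓ) = ℓ h := by
      rw [he, inner_smul_left, hz]
      simp [F, hspos.ne']
    rw [hin] at hcm
    rw [← hcm]
    refine integral_congr_ae ?_
    filter_upwards [hι ℓ] with x hx
    rw [hx, NNReal.smul_def, hρ, Real.coe_toNNReal _ (Real.exp_nonneg _), Complex.real_smul]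
end

section
/- Let W be a real separable Banach space, μ a centered Gaussian measure on W, and h ∈ W a nonzero element admitting a representative h* ∈ W* such that Cov_μ(h*, ℓ) = ℓ(h) for all ℓ ∈ W*, with V := Cov_μ(h*, h*) > 0. Define the Cameron–Martin reflection R_h : W → W by R_h(y) = y − (2 h*(y)/V)·h. Then μ is invariant under R_h: the pushforward measure R_h#μ equals μ. -/
open MeasureTheory ProbabilityTheory NNReal

/-- The Cameron–Martin reflection `R_h(y) = y − (2 h*(y)/V)·h`, where `h* ∈ W*` represents
`h` via the covariance and `V = Cov_μ(h*,h*) > 0`, leaves the centered Gaussian measure `μ`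
invariant: `R_h#μ = μ`. -/
theorem cameronMartin_reflection_invariant
    {W : Type*} [NormedAddCommGroup W] [NormedSpace ℝ W] [CompleteSpace W]
    [TopologicalSpace.SeparableSpace W] [MeasurableSpace W] [BorelSpace W]
    (μ : Measure W) [IsProbabilityMeasure μ] (hμ : IsCenteredGaussian μ)
    (h : W) (hne : h ≠ 0) (hstar : W →L[ℝ] ℝ)
    (hrep : ∀ ℓ : W →L[ℝ] ℝ, (∫ x, hstar x * ℓ x ∂μ) = ℓ h)
    (hV : 0 < ∫ x, hstar x * hstar x ∂μ) :
    μ.map (fun y => y - (2 * hstar y / (∫ x, hstar x * hstar x ∂μ)) • h) = μ := by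
  have hG : IsGaussian μ := by
    refine isGaussian_of_map_eq_gaussianReal fun L => ?_
    obtain ⟨v, hv⟩ := hμ L
    exact ⟨0, v, hv⟩
  have hmean : ∀ L : W →L[ℝ] ℝ, ∫ x, L x ∂μ = 0 := by
    intro L
    obtain ⟨v, hv⟩ := hμ L
    have h1 : ∫ y, y ∂(μ.map L) = ∫ x, L x ∂μ :=
      integral_map (by fun_prop) (by fun_prop)
    rw [← h1, hv, integral_id_gaussianReal]
  have hvar : ∀ L : W →L[ℝ] ℝ, Var[L; μ] = ∫ x, L x * L x ∂μ := by
    intro L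
    rw [variance_of_integral_eq_zero (by fun_prop) (hmean L)]
    simp [sq]
  have hint : ∀ L K : W →L[ℝ] ℝ, Integrable (fun x => L x * K x) μ := fun L K =>
    (IsGaussian.memLp_dual μ L 2 (by norm_num)).integrable_mul
      (IsGaussian.memLp_dual μ K 2 (by norm_num))
  set V := ∫ x, hstar x * hstar x ∂μ with hVdef
  let R : W →L[ℝ] W := ContinuousLinearMap.id ℝ W - ((2 / V) • hstar).smulRight h
  have hR : (fun y => y - (2 * hstar y / V) • h) = R := by
    funext y
    simp [R, div_mul_eq_mul_div]
  rw [hR]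
  have : SecondCountableTopology W := UniformSpace.secondCountable_of_separable W
  refine Measure.ext_of_charFunDual (funext fun L => ?_)
  rw [charFunDual_map, IsGaussian.charFunDual_eq, IsGaussian.charFunDual_eq]
  have hv : Var[(L ∘L R); μ] = Var[L; μ] := by
    rw [hvar, hvar]
    have h1 : ∀ x, (L ∘L R) x * (L ∘L R) x = L x * L x - (4 * L h / V) * (hstar x * L x)
        + (4 * L h ^ 2 / V ^ 2) * (hstar x * hstar x) := by
      intro x
      simp [R]
      ring
    simp_rw [h1]
    have h2 : Integrable (fun x => L x * L x - (4 * L h / V) * (hstar x * L x)) μ :=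
      (hint L L).sub ((hint hstar L).const_mul _)
    rw [integral_add h2 ((hint _ _).const_mul _),
      integral_sub (hint L L) ((hint hstar L).const_mul _), integral_const_mul,
      integral_const_mul, hrep L, ← hVdef]
    field_simp
    ring
  have hm : ∀ L : W →L[ℝ] ℝ, ∫ x, (L x : ℂ) ∂μ = 0 := by
    intro L
    rw [integral_complex_ofReal, hmean L]; simp
  rw [hv, hm, hm]
end

section
/- (Reflection principle.) Let B = (B_t)_{t≥0} be a standard real Brownian motion on a probability space (Ω, F, P): B has almost surely continuous sample paths, B_0 = 0 almost surely, independent increments, and B_t − B_s is distributed N(0, t−s) for all 0 ≤ s ≤ t. Then for every b > 0 and t > 0: P(∃ s ∈ [0,t] with B_s ≥ b) = 2 P(B_t ≥ b) = 2·γ₁([b/√t, ∞)), where γ₁ is the standard Gaussian measure N(0,1) on ℝ. -/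
open MeasureTheory ProbabilityTheory NNReal

section Helpers

open Filter Topology Set

variable {Ω : Type*} [MeasurableSpace Ω]

/-- First passage event at index `k`. -/
def fstPass (X : ℕ → Ω → ℝ) (a : ℝ) (k : ℕ) : Set Ω :=
  {ω | (∀ j < k, X j ω < a) ∧ a ≤ X k ω}

lemma fstPass_meas (m : MeasurableSpace Ω) (X : ℕ → Ω → ℝ) (a : ℝ) (k : ℕ)
    (h : ∀ j ≤ k, Measurable[m] (X j)) : MeasurableSet[m] (fstPass X a k) := by
  have : fstPass X a k = (⋂ j, ⋂ (_ : j < k), X j ⁻¹' (Iio a)) ∩ X k ⁻¹' (Ici a) := by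
    ext ω; simp [fstPass]
  rw [this]
  refine MeasurableSet.inter (MeasurableSet.iInter fun j => MeasurableSet.iInter fun hj => ?_) ?_
  · exact h j hj.le measurableSet_Iio
  · exact h k le_rfl measurableSet_Ici

lemma fstPass_disj (X : ℕ → Ω → ℝ) (a : ℝ) {i j : ℕ} (hij : i ≠ j) :
    Disjoint (fstPass X a i) (fstPass X a j) := by
  rw [Set.disjoint_left]
  rintro ω ⟨h1, h2⟩ ⟨h3, h4⟩
  rcases lt_or_gt_of_ne hij with h | h
  · exact absurd (h3 i h) (not_lt.2 h2)
  · exact absurd (h1 j h) (not_lt.2 h4)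

lemma exists_fstPass (X : ℕ → Ω → ℝ) (a : ℝ) (N : ℕ) (ω : Ω) :
    (∃ k ≤ N, a ≤ X k ω) ↔ ∃ k ∈ Finset.range (N+1), ω ∈ fstPass X a k := by
  classical
  constructor
  · rintro ⟨k, hk, hak⟩
    have hex : ∃ k, a ≤ X k ω := ⟨k, hak⟩
    refine ⟨Nat.find hex, ?_, ?_, Nat.find_spec hex⟩
    · have := Nat.find_min' hex hak
      exact Finset.mem_range.2 (by omega)
    · intro j hj
      exact not_le.1 (Nat.find_min hex hj)
  · rintro ⟨k, hk, h1, h2⟩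
    exact ⟨k, by simp at hk; omega, h2⟩

lemma sum_fstPass (P : Measure Ω) (X : ℕ → Ω → ℝ) (hX : ∀ k, Measurable (X k)) (a : ℝ) (N : ℕ)
    (S : Set Ω) (hS : MeasurableSet S) :
    P ({ω | ∃ k ≤ N, a ≤ X k ω} ∩ S) = ∑ k ∈ Finset.range (N+1), P (fstPass X a k ∩ S) := by
  rw [← measure_biUnion_finset]
  · congr 1
    ext ω
    simp only [mem_inter_iff, mem_ofPred_eq, exists_fstPass, mem_iUnion]
    constructor
    · rintro ⟨⟨k, hk, h⟩, hs⟩; exact ⟨k, hk, h, hs⟩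
    · rintro ⟨k, hk, h, hs⟩; exact ⟨⟨k, hk, h⟩, hs⟩
  · intro i _ j _ hij
    exact (fstPass_disj X a hij).mono inter_subset_left inter_subset_left
  · intro k _
    exact (fstPass_meas _ X a k fun j _ => hX j).inter hS

/-- Discrete estimates from conditional symmetry. -/
lemma disc_upper (P : Measure Ω) (X : ℕ → Ω → ℝ) (hX : ∀ k, Measurable (X k)) (N : ℕ)
    (hsymm : ∀ k ≤ N, ∀ E : Set Ω,
      MeasurableSet[⨆ j ∈ Iic k, MeasurableSpace.comap (X j) (borel ℝ)] E → ∀ x : ℝ,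
      P (E ∩ {ω | x ≤ X N ω - X k ω}) = P (E ∩ {ω | X N ω - X k ω ≤ -x})) (a : ℝ) :
    P {ω | ∃ k ≤ N, a ≤ X k ω} ≤ 2 * P {ω | a ≤ X N ω} := by
  have hm : ∀ k, ∀ j ≤ k,
      Measurable[⨆ j ∈ Iic k, MeasurableSpace.comap (X j) (borel ℝ)] (X j) := by
    intro k j hj
    rw [measurable_iff_comap_le]
    exact le_iSup₂_of_le (f := fun j (_ : j ∈ Iic k) => MeasurableSpace.comap (X j) (borel ℝ))
      j hj le_rfl
  have h1 := sum_fstPass P X hX a N univ MeasurableSet.univ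
  have h2 := sum_fstPass P X hX a N {ω | a ≤ X N ω} (measurableSet_le measurable_const (hX N))
  have h3 : P {ω | a ≤ X N ω} = P ({ω | ∃ k ≤ N, a ≤ X k ω} ∩ {ω | a ≤ X N ω}) := by
    congr 1; ext ω; simp only [mem_inter_iff, mem_ofPred_eq]
    exact ⟨fun h => ⟨⟨N, le_rfl, h⟩, h⟩, fun h => h.2⟩
  rw [h3, h2]
  simp only [inter_univ] at h1
  rw [h1, Finset.mul_sum]
  refine Finset.sum_le_sum fun k hk => ?_
  have hk' : k ≤ N := by simp at hk; omega
  have hs := hsymm k hk' _ (fstPass_meas _ X a k (hm k)) 0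
  calc P (fstPass X a k) ≤ P (fstPass X a k ∩ {ω | 0 ≤ X N ω - X k ω}) +
        P (fstPass X a k ∩ {ω | X N ω - X k ω ≤ -0}) := by
        refine le_trans (measure_mono ?_) (measure_union_le _ _)
        intro ω hω
        rcases le_total 0 (X N ω - X k ω) with h | h
        · exact Or.inl ⟨hω, h⟩
        · exact Or.inr ⟨hω, by simpa using h⟩
    _ = 2 * P (fstPass X a k ∩ {ω | 0 ≤ X N ω - X k ω}) := by rw [← hs, two_mul]
    _ ≤ _ := by
        refine mul_le_mul_right (measure_mono ?_) 2
        rintro ω ⟨h1, h2⟩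
        refine ⟨h1, ?_⟩
        have := h1.2
        simp only [mem_ofPred_eq] at h2 ⊢
        linarith

lemma disc_lower (P : Measure Ω) (X : ℕ → Ω → ℝ) (hX : ∀ k, Measurable (X k)) (N : ℕ)
    (hsymm : ∀ k ≤ N, ∀ E : Set Ω,
      MeasurableSet[⨆ j ∈ Iic k, MeasurableSpace.comap (X j) (borel ℝ)] E → ∀ x : ℝ,
      P (E ∩ {ω | x ≤ X N ω - X k ω}) = P (E ∩ {ω | X N ω - X k ω ≤ -x})) (a ε : ℝ)
    (hε : 0 < ε) :
    P {ω | a ≤ X N ω} + P {ω | a + 2 * ε ≤ X N ω} ≤ P {ω | ∃ k ≤ N, a ≤ X k ω} +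
      P {ω | a ≤ X 0 ω ∨ ∃ k < N, ε ≤ X (k+1) ω - X k ω} := by
  have hm : ∀ k, ∀ j ≤ k,
      Measurable[⨆ j ∈ Iic k, MeasurableSpace.comap (X j) (borel ℝ)] (X j) := by
    intro k j hj
    rw [measurable_iff_comap_le]
    exact le_iSup₂_of_le (f := fun j (_ : j ∈ Iic k) => MeasurableSpace.comap (X j) (borel ℝ))
      j hj le_rfl
  set O := {ω | a ≤ X 0 ω ∨ ∃ k < N, ε ≤ X (k+1) ω - X k ω} with hO
  have hOm : MeasurableSet O := by
    have : O = X 0 ⁻¹' (Ici a) ∪ ⋃ k, ⋃ (_ : k < N), {ω | ε ≤ X (k+1) ω - X k ω} := by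
      ext ω; simp [hO]
    rw [this]
    exact (hX 0 measurableSet_Ici).union (MeasurableSet.iUnion fun k => MeasurableSet.iUnion
      fun _ => measurableSet_le measurable_const ((hX _).sub (hX _)))
  set A := {ω | ∃ k ≤ N, a ≤ X k ω} with hA
  have hT : MeasurableSet {ω | a ≤ X N ω} := measurableSet_le measurable_const (hX N)
  have hT2 : MeasurableSet {ω | a + 2 * ε ≤ X N ω} := measurableSet_le measurable_const (hX N)
  have key : P (A ∩ ({ω | a + 2 * ε ≤ X N ω} ∩ Oᶜ)) ≤ P (A ∩ {ω | a ≤ X N ω}ᶜ) := by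
    rw [hA, sum_fstPass P X hX a N _ (hT2.inter hOm.compl), sum_fstPass P X hX a N _ hT.compl]
    refine Finset.sum_le_sum fun k hk => ?_
    have hk' : k ≤ N := by simp at hk; omega
    have hs := hsymm k hk' (fstPass X a k ∩ X k ⁻¹' (Iio (a + ε)))
      ((fstPass_meas _ X a k (hm k)).inter (hm k k le_rfl measurableSet_Iio)) ε
    calc _ ≤ P (fstPass X a k ∩ X k ⁻¹' (Iio (a + ε)) ∩ {ω | ε ≤ X N ω - X k ω}) := by
          refine measure_mono ?_
          rintro ω ⟨h1, h2, h3⟩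
          have h4 : X k ω < a + ε := by
            simp only [hO, mem_compl_iff, mem_ofPred_eq, not_or, not_exists, not_and, not_le] at h3
            rcases k with _ | k
            · linarith [h3.1]
            · have := h3.2 k (by omega)
              have := h1.1 k (by omega)
              linarith
          simp only [mem_ofPred_eq] at h2
          refine ⟨⟨h1, h4⟩, ?_⟩
          simp only [mem_ofPred_eq]; linarith
      _ = _ := hs
      _ ≤ _ := by
          refine measure_mono ?_
          rintro ω ⟨⟨h1, h2⟩, h3⟩
          refine ⟨h1, ?_⟩
          simp only [mem_ofPred_eq, mem_compl_iff, not_le, mem_preimage, mem_Iio] at *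
          linarith
  have h5 : P {ω | a + 2 * ε ≤ X N ω} ≤ P (A ∩ ({ω | a + 2 * ε ≤ X N ω} ∩ Oᶜ)) + P O := by
    refine le_trans (measure_mono ?_) (measure_union_le _ _)
    intro ω hω
    by_cases h : ω ∈ O
    · exact Or.inr h
    · refine Or.inl ⟨⟨N, le_rfl, ?_⟩, hω, h⟩
      simp only [mem_ofPred_eq] at hω
      linarith
  have h6 : P {ω | a ≤ X N ω} = P (A ∩ {ω | a ≤ X N ω}) := by
    congr 1; ext ω; simp only [hA, mem_inter_iff, mem_ofPred_eq]
    exact ⟨fun h => ⟨⟨N, le_rfl, h⟩, h⟩, fun h => h.2⟩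
  calc _ ≤ P (A ∩ {ω | a ≤ X N ω}) + (P (A ∩ {ω | a ≤ X N ω}ᶜ) + P O) := by
        rw [← h6]; gcongr; exact h5.trans (by gcongr)
    _ = _ := by rw [← add_assoc, ← measure_inter_add_sdiff A hT]; rfl

/-- Uniform grid. -/
noncomputable def grid (t : ℝ≥0) (n k : ℕ) : ℝ≥0 := t * (k / (n + 1))

lemma grid_mono (t : ℝ≥0) (n : ℕ) : Monotone (grid t n) := by
  intro i j hij
  unfold grid
  gcongr

lemma grid_last (t : ℝ≥0) (n : ℕ) : grid t n (n+1) = t := by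
  unfold grid
  push_cast
  rw [div_self (by positivity), mul_one]

lemma grid_dist (t : ℝ≥0) (n k : ℕ) : dist (grid t n (k+1)) (grid t n k) ≤ t / (n + 1) := by
  have : ((grid t n (k+1) : ℝ≥0) : ℝ) - grid t n k = t / (n+1) := by
    simp only [grid]; push_cast; ring
  rw [NNReal.dist_eq, this, abs_of_nonneg (by positivity)]

lemma grid_close (t : ℝ≥0) (ht : 0 < t) (n : ℕ) (s : ℝ≥0) (hs : s ≤ t) :
    ∃ k ≤ n + 1, dist (grid t n k) s ≤ t / (n + 1) := by
  have ht' : (0:ℝ) < t := ht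
  have hn : (0:ℝ) < (n:ℝ) + 1 := by positivity
  have hs' : (s:ℝ) ≤ t := hs
  set x : ℝ := s * (n + 1) / t with hx
  have hx0 : 0 ≤ x := by positivity
  have hxn : x ≤ n + 1 := by
    rw [hx, div_le_iff₀ ht', mul_comm]; gcongr
  refine ⟨⌊x⌋₊, ?_, ?_⟩
  · have := Nat.floor_le_floor (R := ℝ) (a := x) (b := ((n+1 : ℕ):ℝ)) (by push_cast; exact hxn)
    rwa [Nat.floor_natCast] at this
  · have h1 := Nat.floor_le hx0
    have h2 := Nat.lt_floor_add_one x
    have h3 : (s:ℝ) = t / (n+1) * x := by rw [hx]; field_simp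
    have h4 : ((grid t n ⌊x⌋₊ : ℝ≥0) : ℝ) = t / (n+1) * (⌊x⌋₊ : ℝ) := by
      simp only [grid]; push_cast; ring
    have hp : (0:ℝ) < t / (n+1) := by positivity
    rw [NNReal.dist_eq, h4, h3, ← mul_sub, abs_mul, abs_of_pos hp]
    refine mul_le_of_le_one_right hp.le ?_
    rw [abs_le]; constructor <;> linarith

lemma unif (f : ℝ≥0 → ℝ) (hf : Continuous f) (t : ℝ≥0) (ε : ℝ) (hε : 0 < ε) :
    ∀ᶠ n : ℕ in atTop, ∀ s ≤ t, ∀ u ≤ t, dist s u ≤ t / ((n:ℝ) + 1) → |f s - f u| < ε := by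
  have huc : UniformContinuousOn f (Icc 0 t) :=
    isCompact_Icc.uniformContinuousOn_of_continuous hf.continuousOn
  rw [Metric.uniformContinuousOn_iff] at huc
  obtain ⟨δ, hδ, h⟩ := huc ε hε
  have hlim : Tendsto (fun n : ℕ => (t:ℝ) / ((n:ℝ) + 1)) atTop (𝓝 0) :=
    tendsto_const_div_atTop_nhds_zero_nat (t:ℝ) |>.comp (tendsto_add_atTop_nat 1) |>.congr
      (fun n => by simp)
  filter_upwards [hlim.eventually (gt_mem_nhds hδ)] with n hn s hs u hu hd
  exact h s ⟨zero_le, hs⟩ u ⟨zero_le, hu⟩ (hd.trans_lt hn)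

end Helpers

open Filter Topology Set in
/-- Reflection principle for standard real Brownian motion: for `b > 0` and `t > 0`,
`P(∃ s ∈ [0,t], B s ≥ b) = 2 P(B t ≥ b) = 2 γ₁([b/√t, ∞))`, where `γ₁ = N(0,1)`. -/
theorem brownian_reflection_principle
    {Ω : Type*} [MeasurableSpace Ω] (P : Measure Ω) [IsProbabilityMeasure P]
    (B : ℝ≥0 → Ω → ℝ) (hmeas : ∀ t, Measurable (B t))
    (hcont : ∀ᵐ ω ∂P, Continuous fun t => B t ω)
    (h0 : ∀ᵐ ω ∂P, B 0 ω = 0)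
    (hindep : ∀ s t : ℝ≥0, s ≤ t →
        Indep (MeasurableSpace.comap (fun ω => B t ω - B s ω) (borel ℝ))
          (⨆ u ∈ Set.Iic s, MeasurableSpace.comap (B u) (borel ℝ)) P)
    (hgauss : ∀ s t : ℝ≥0, s ≤ t →
        P.map (fun ω => B t ω - B s ω) = gaussianReal 0 (t - s))
    (b : ℝ) (hb : 0 < b) (t : ℝ≥0) (ht : 0 < t) :
    P {ω | ∃ s : ℝ≥0, s ≤ t ∧ b ≤ B s ω} = 2 * P {ω | b ≤ B t ω}
    ∧ P {ω | ∃ s : ℝ≥0, s ≤ t ∧ b ≤ B s ω}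
        = 2 * gaussianReal 0 1 (Set.Ici (b / Real.sqrt (t : ℝ))) := by
  have ht' : (0:ℝ) < t := ht
  have hlaw : P.map (B t) = gaussianReal 0 t := by
    have := hgauss 0 t zero_le
    rw [tsub_zero] at this
    rw [← this]
    refine Measure.map_congr ?_
    filter_upwards [h0] with ω hω
    simp [hω]
  have hPt : ∀ S, MeasurableSet S → P (B t ⁻¹' S) = gaussianReal 0 t S := fun S hS => by
    rw [← hlaw, Measure.map_apply (hmeas t) hS]
  have hG : P {ω | b ≤ B t ω} = gaussianReal 0 1 (Set.Ici (b / Real.sqrt (t : ℝ))) := by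
    have h1 : P {ω | b ≤ B t ω} = gaussianReal 0 t (Ici b) := hPt _ measurableSet_Ici
    have hsq : 0 < Real.sqrt t := Real.sqrt_pos.2 ht'
    have h2 : (gaussianReal 0 1).map (Real.sqrt t * ·) = gaussianReal 0 t := by
      rw [gaussianReal_map_const_mul]
      congr 1
      · simp
      · ext; simp
    rw [h1, ← h2, Measure.map_apply (by fun_prop) measurableSet_Ici]
    congr 1
    ext x
    simp only [mem_preimage, mem_Ici]
    rw [div_le_iff₀ hsq, mul_comm]
  suffices hmain : P {ω | ∃ s : ℝ≥0, s ≤ t ∧ b ≤ B s ω} = 2 * P {ω | b ≤ B t ω} from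
    ⟨hmain, by rw [hmain, hG]⟩
  have hXm : ∀ n k, Measurable (B (grid t n k)) := fun n k => hmeas _
  have hsymm : ∀ n, ∀ k ≤ n + 1, ∀ E : Set Ω,
      MeasurableSet[⨆ j ∈ Iic k, MeasurableSpace.comap (B (grid t n j)) (borel ℝ)] E → ∀ x : ℝ,
      P (E ∩ {ω | x ≤ B (grid t n (n+1)) ω - B (grid t n k) ω})
        = P (E ∩ {ω | B (grid t n (n+1)) ω - B (grid t n k) ω ≤ -x}) := by
    intro n k hk E hE x
    have hle := grid_mono t n hk
    have hi := hindep _ _ hle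
    have hg := hgauss _ _ hle
    set D := fun ω => B (grid t n (n+1)) ω - B (grid t n k) ω with hD
    have hDm : Measurable D := (hmeas _).sub (hmeas _)
    have hE' : MeasurableSet[⨆ u ∈ Set.Iic (grid t n k), MeasurableSpace.comap (B u) (borel ℝ)] E := by
      have hle2 : (⨆ j ∈ Iic k, MeasurableSpace.comap (B (grid t n j)) (borel ℝ)) ≤
          ⨆ u ∈ Set.Iic (grid t n k), MeasurableSpace.comap (B u) (borel ℝ) := by
        refine iSup₂_le fun j hj => ?_
        exact le_iSup₂_of_le (f := fun u (_ : u ∈ Iic (grid t n k)) =>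
          MeasurableSpace.comap (B u) (borel ℝ)) (grid t n j) (grid_mono t n hj) le_rfl
      exact hle2 E hE
    rw [Indep_iff] at hi
    have e1 := hi (D ⁻¹' Ici x) E ⟨Ici x, measurableSet_Ici, rfl⟩ hE'
    have e2 := hi (D ⁻¹' Iic (-x)) E ⟨Iic (-x), measurableSet_Iic, rfl⟩ hE'
    have e3 : P (D ⁻¹' Ici x) = P (D ⁻¹' Iic (-x)) := by
      rw [← Measure.map_apply hDm measurableSet_Ici, ← Measure.map_apply hDm measurableSet_Iic, hg]
      have := gaussianReal_map_neg (μ := 0) (v := grid t n (n+1) - grid t n k)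
      rw [neg_zero] at this
      conv_rhs => rw [← this]
      rw [Measure.map_apply measurable_neg measurableSet_Iic]
      congr 1
      ext y; simp
    rw [inter_comm, inter_comm E]
    exact e1.trans (by rw [e3]; exact e2.symm)
  -- upper bound
  have hup : ∀ ε : ℝ, 0 < ε →
      P {ω | ∃ s : ℝ≥0, s ≤ t ∧ b ≤ B s ω} ≤ 2 * P {ω | b - ε ≤ B t ω} := by
    intro ε hε
    set A : ℕ → Set Ω := fun n => {ω | ∃ k ≤ n + 1, b - ε ≤ B (grid t n k) ω} with hA
    have hAle : ∀ n, P (A n) ≤ 2 * P {ω | b - ε ≤ B t ω} := by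
      intro n
      have := disc_upper P (fun k => B (grid t n k)) (hXm n) (n+1) (hsymm n) (b - ε)
      simpa only [grid_last] using this
    have hsub : P {ω | ∃ s : ℝ≥0, s ≤ t ∧ b ≤ B s ω} ≤ P (⋃ n, ⋂ m ≥ n, A m) := by
      refine measure_mono_ae ?_
      filter_upwards [hcont] with ω hω hs
      obtain ⟨s, hst, hbs⟩ := hs
      obtain ⟨n, hn⟩ := eventually_atTop.1 (unif _ hω t ε hε)
      refine mem_iUnion.2 ⟨n, mem_iInter₂.2 fun m hm => ?_⟩
      obtain ⟨k, hk, hd⟩ := grid_close t ht m s hst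
      have hkt : grid t m k ≤ t := (grid_mono t m hk).trans_eq (grid_last t m)
      have := (abs_lt.1 (hn m hm _ hkt s hst hd)).1
      exact ⟨k, hk, by linarith⟩
    refine hsub.trans ?_
    rw [Monotone.measure_iUnion]
    · exact iSup_le fun n => (measure_mono (iInter₂_subset n le_rfl)).trans (hAle n)
    · intro i j hij
      exact biInter_subset_biInter_left fun m (hm : m ≥ j) => le_trans hij hm
  -- lower bound
  have hlow : ∀ ε : ℝ, 0 < ε →
      P {ω | b ≤ B t ω} + P {ω | b + 2 * ε ≤ B t ω} ≤ P {ω | ∃ s : ℝ≥0, s ≤ t ∧ b ≤ B s ω} := by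
    intro ε hε
    set O : ℕ → Set Ω := fun n => {ω | b ≤ B (grid t n 0) ω ∨
      ∃ k < n + 1, ε ≤ B (grid t n (k+1)) ω - B (grid t n k) ω} with hO
    have hOm : ∀ n, MeasurableSet (O n) := by
      intro n
      have : O n = B (grid t n 0) ⁻¹' (Ici b) ∪
          ⋃ k, ⋃ (_ : k < n + 1), {ω | ε ≤ B (grid t n (k+1)) ω - B (grid t n k) ω} := by
        ext ω; simp [hO]
      rw [this]
      exact (hmeas _ measurableSet_Ici).union (MeasurableSet.iUnion fun k => MeasurableSet.iUnion
        fun _ => measurableSet_le measurable_const ((hmeas _).sub (hmeas _)))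
    have hlim : Tendsto (fun n => P (O n)) atTop (𝓝 (P ∅)) := by
      refine tendsto_measure_of_ae_tendsto_indicator_of_isFiniteMeasure atTop
        MeasurableSet.empty hOm ?_
      filter_upwards [hcont, h0] with ω hω hω0
      filter_upwards [unif _ hω t ε hε] with n hn
      simp only [mem_empty_iff_false, iff_false]
      rintro (h | ⟨k, hk, h⟩)
      · have : grid t n 0 = 0 := by simp [grid]
        rw [this, hω0] at h
        linarith
      · have h1 : grid t n k ≤ t := (grid_mono t n hk.le).trans_eq (grid_last t n)
        have h2 : grid t n (k+1) ≤ t := (grid_mono t n hk).trans_eq (grid_last t n)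
        have := (abs_lt.1 (hn _ h2 _ h1 (grid_dist t n k))).2
        linarith
    have hle : ∀ n, P {ω | b ≤ B t ω} + P {ω | b + 2 * ε ≤ B t ω} ≤
        P {ω | ∃ s : ℝ≥0, s ≤ t ∧ b ≤ B s ω} + P (O n) := by
      intro n
      have := disc_lower P (fun k => B (grid t n k)) (hXm n) (n+1) (hsymm n) b ε hε
      simp only [grid_last] at this
      refine this.trans (add_le_add (measure_mono ?_) le_rfl)
      rintro ω ⟨k, hk, h⟩
      exact ⟨_, (grid_mono t n hk).trans_eq (grid_last t n), h⟩
    have hl2 := hlim.const_add (P {ω | ∃ s : ℝ≥0, s ≤ t ∧ b ≤ B s ω})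
    rw [measure_empty, add_zero] at hl2
    exact ge_of_tendsto' hl2 hle
  have hpos : ∀ n : ℕ, (0:ℝ) < 1 / ((n:ℝ) + 1) := fun n => by positivity
  have hanti : Antitone fun n : ℕ => 1 / ((n:ℝ) + 1) := by
    intro i j hij
    dsimp only
    gcongr
  have h1n : Tendsto (fun n : ℕ => 1 / ((n:ℝ) + 1)) atTop (𝓝 0) :=
    tendsto_one_div_add_atTop_nhds_zero_nat
  apply le_antisymm
  · have hl : Tendsto (fun n : ℕ => P {ω | b - 1 / ((n:ℝ) + 1) ≤ B t ω}) atTop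
        (𝓝 (P (⋂ n : ℕ, {ω | b - 1 / ((n:ℝ) + 1) ≤ B t ω}))) := by
      refine tendsto_measure_iInter_atTop
        (fun n => (measurableSet_le measurable_const (hmeas t)).nullMeasurableSet) ?_
        ⟨0, measure_ne_top _ _⟩
      intro i j hij ω hω
      have := hanti hij
      simp only [mem_ofPred_eq] at *
      linarith
    have he : (⋂ n : ℕ, {ω | b - 1 / ((n:ℝ) + 1) ≤ B t ω}) = {ω | b ≤ B t ω} := by
      ext ω
      simp only [mem_iInter, mem_ofPred_eq]
      constructor
      · intro h
        have := h1n.const_sub b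
        rw [sub_zero] at this
        exact le_of_tendsto' this h
      · intro h n
        linarith [hpos n]
    rw [he] at hl
    exact ge_of_tendsto' (ENNReal.Tendsto.const_mul hl (Or.inr (by simp))) fun n => hup _ (hpos n)
  · have hl : Tendsto (fun n : ℕ => P {ω | b + 2 * (1 / ((n:ℝ) + 1)) ≤ B t ω}) atTop
        (𝓝 (P (⋃ n : ℕ, {ω | b + 2 * (1 / ((n:ℝ) + 1)) ≤ B t ω}))) := by
      refine tendsto_measure_iUnion_atTop ?_
      intro i j hij ω hω
      have := hanti hij
      simp only [mem_ofPred_eq] at *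
      linarith
    have he : (⋃ n : ℕ, {ω | b + 2 * (1 / ((n:ℝ) + 1)) ≤ B t ω}) = B t ⁻¹' Ioi b := by
      ext ω
      simp only [mem_iUnion, mem_ofPred_eq, mem_preimage, mem_Ioi]
      constructor
      · rintro ⟨n, h⟩
        linarith [hpos n]
      · intro h
        obtain ⟨n, hn⟩ := exists_nat_one_div_lt (show 0 < (B t ω - b) / 2 by linarith)
        exact ⟨n, by linarith⟩
    have hat : P (B t ⁻¹' Ioi b) = P {ω | b ≤ B t ω} := by
      have : P {ω | b ≤ B t ω} = gaussianReal 0 t (Ici b) := hPt _ measurableSet_Ici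
      rw [this, hPt _ measurableSet_Ioi]
      have : NullSingletonClass (gaussianReal 0 t) := nullSingletonClass_gaussianReal ht.ne'
      exact measure_congr Ioi_ae_eq_Ici
    rw [he, hat] at hl
    rw [two_mul]
    exact le_of_tendsto' (hl.const_add _) fun n => hlow _ (hpos n)
end

section
/- Let W be a real separable Banach space and μ a centered Gaussian measure on W. Then for every ℓ ∈ W*, the map x ↦ ℓ(x)·x is Bochner μ-integrable, and the barycenter m_ℓ = ∫_W ℓ(x)·x dμ(x) ∈ W represents the covariance: for every ℓ′ ∈ W*, ℓ′(m_ℓ) = Cov_μ(ℓ, ℓ′) = ∫_W ℓ(x) ℓ′(x) dμ(x). -/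
open MeasureTheory ProbabilityTheory NNReal

/-- For a centered Gaussian measure `μ` on a separable Banach space and every `ℓ ∈ W*`,
the map `x ↦ ℓ(x)·x` is Bochner `μ`-integrable and the barycenter `m_ℓ = ∫ ℓ(x)·x dμ(x)`
represents the covariance: `ℓ'(m_ℓ) = ∫ ℓ(x) ℓ'(x) dμ(x)` for every `ℓ' ∈ W*`. -/
theorem covariance_barycenter
    {W : Type*} [NormedAddCommGroup W] [NormedSpace ℝ W] [CompleteSpace W]
    [TopologicalSpace.SeparableSpace W] [MeasurableSpace W] [BorelSpace W]
    (μ : Measure W) [IsProbabilityMeasure μ] (hμ : IsCenteredGaussian μ) :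
    ∀ ℓ : W →L[ℝ] ℝ,
      Integrable (fun x => ℓ x • x) μ
      ∧ ∀ ℓ' : W →L[ℝ] ℝ, ℓ' (∫ x, ℓ x • x ∂μ) = ∫ x, ℓ x * ℓ' x ∂μ := by
  intro ℓ
  have : SecondCountableTopology W := UniformSpace.secondCountable_of_separable W
  have : IsGaussian μ := ⟨fun L => by
    obtain ⟨v, hv⟩ := hμ L
    have hL : AEMeasurable (fun x => L x) μ := L.continuous.measurable.aemeasurable
    have h1 : ∫ x, L x ∂μ = 0 := by
      have h := integral_map (μ := μ) hL (f := fun y : ℝ => y) (by fun_prop)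
      rw [← h, hv]
      exact integral_id_gaussianReal
    have h2 : Var[L; μ] = v := by
      rw [← variance_id_map hL, hv, variance_id_gaussianReal]
    rw [hv, h1, h2]
    simp⟩
  have h2 : MemLp (id : W → W) 2 μ := IsGaussian.memLp_two_id
  have hℓ : MemLp (fun x => ℓ x) 2 μ := ℓ.comp_memLp' h2
  have hint : Integrable (fun x => ℓ x • x) μ :=
    memLp_one_iff_integrable.mp (h2.smul hℓ)
  refine ⟨hint, fun ℓ' => ?_⟩
  rw [← ContinuousLinearMap.integral_comp_comm ℓ' hint]
  simp
end
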